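/- arXiv:2203.15148 — 4 statements merged into one kernel-verified Lean document; each statement's English description precedes it below -/
import Mathlib

section
/- For the Grover-coin discrete-time coined quantum walk on a finite group G with generating set S, started from the uniform superposition over the coin at the identity, the amplitudes admit the character-sum expression: for every t ≥ 1, s ∈ S and g ∈ G, α_{s,t}(g) = (1/(√d · N)) · ∑_{k=0}^{t−1} a^{t−k−1} b^k · ∑_{ρ ∈ Ĝ} ∑_{w ∈ R_{k,t,s}} d_ρ · χ_ρ(g⁻¹ · (w_1 w_2 ⋯ w_t)). -/
/-- `wordSet S n k s` is the set `R_{k,n+1,s}` of words `w = (w_1, …, w_{n+1})` over the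
generating set `S` whose last letter is `s` and which have exactly `k` adjacent indices `i`
with `w_i ≠ w_{i+1}`. -/
def wordSet {G : Type} [Group G] [Fintype G] [DecidableEq G]
    (S : Finset G) (n k : ℕ) (s : G) : Finset (Fin (n + 1) → G) :=
  Finset.univ.filter fun w =>
    (∀ i, w i ∈ S) ∧ w (Fin.last n) = s ∧
      (Finset.univ.filter fun i : Fin n => w i.castSucc ≠ w i.succ).card = k

/-- The trace character of a direct sum of complementary subrepresentations is additive. -/
theorem character_eq_add_of_isCompl {k G V : Type*} [Field k] [Monoid G] [AddCommGroup V]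
    [Module k V] [FiniteDimensional k V] {ρ : Representation k G V}
    {σ τ : Subrepresentation ρ} (h : IsCompl σ τ) (g : G) :
    ρ.character g = σ.toRepresentation.character g + τ.toRepresentation.character g := by
  have hc : IsCompl σ.toSubmodule τ.toSubmodule := by
    refine ⟨disjoint_iff.2 ?_, codisjoint_iff.2 ?_⟩
    · rw [← Subrepresentation.toSubmodule_inf, h.inf_eq_bot]; rfl
    · rw [← Subrepresentation.toSubmodule_sup, h.sup_eq_top]; rfl
  simp only [Representation.character]
  rw [← LinearMap.trace_prodMap', ← LinearMap.trace_conj' _ (Submodule.prodEquivOfIsCompl _ _ hc)]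
  congr 1
  rw [LinearEquiv.conj_apply, LinearEquiv.eq_comp_toLinearMap_symm]
  ext x <;> simp [Subrepresentation.toRepresentation]

/-- An irreducible representation bundles to a simple object of `FDRep`. -/
theorem simple_of_isIrreducible {G V : Type} [Group G] [Fintype G] [AddCommGroup V]
    [Module ℂ V] [FiniteDimensional ℂ V] (ρ : Representation ℂ G V) [ρ.IsIrreducible] :
    CategoryTheory.Simple (FDRep.of ρ) := by
  have hN : (Nat.card G : ℂ) ≠ 0 := NeZero.ne _
  have := invertibleOfNonzero hN
  rw [FDRep.simple_iff_char_is_norm_one]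
  have h := Representation.char_orthonormal ρ ρ
  rw [if_pos ⟨.refl ρ⟩, inv_mul_eq_one₀ hN] at h
  exact h.symm

/-- Every character is a natural number combination of the characters of a complete family of
irreducible representations. -/
theorem exists_character_eq_sum {G : Type} [Group G] [Fintype G] {ι : Type} [Fintype ι]
    (Irr : ι → FDRep ℂ G)
    (hcomplete : ∀ V : FDRep ℂ G, CategoryTheory.Simple V → ∃ i, Nonempty (V ≅ Irr i))
    {V : Type} [AddCommGroup V] [Module ℂ V] [FiniteDimensional ℂ V]
    (ρ : Representation ℂ G V) :
    ∃ n : ι → ℕ, ∀ g, ρ.character g = ∑ i, (n i : ℂ) * (Irr i).character g := by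
  classical
  induction hn : Module.finrank ℂ V using Nat.strong_induction_on generalizing V with
  | _ m ih =>
  subst hn
  by_cases hirr : ρ.IsIrreducible
  · obtain ⟨i, ⟨e⟩⟩ := hcomplete (FDRep.of ρ) (simple_of_isIrreducible ρ)
    refine ⟨Pi.single i 1, fun g => ?_⟩
    have h : ρ.character g = (Irr i).character g := congrFun (FDRep.char_iso e) g
    rw [h, Finset.sum_eq_single i] <;> simp +contextual
  · cases subsingleton_or_nontrivial V with
    | inl hV =>
      refine ⟨0, fun g => ?_⟩
      have : ρ g = 0 := Subsingleton.elim _ _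
      simp [Representation.character, this]
    | inr hV =>
      have : Nontrivial (Subrepresentation ρ) :=
        ⟨⊥, ⊤, fun h => bot_ne_top (α := Submodule ℂ V)
          (congrArg Subrepresentation.toSubmodule h)⟩
      obtain ⟨σ, hbot, htop⟩ : ∃ σ : Subrepresentation ρ, σ ≠ ⊥ ∧ σ ≠ ⊤ := by
        by_contra! h
        exact hirr ⟨fun σ => or_iff_not_imp_left.2 (h σ)⟩
      obtain ⟨τ, hc⟩ := exists_isCompl σ
      have key : ∀ σ : Subrepresentation ρ, σ ≠ ⊤ →
          Module.finrank ℂ σ.toSubmodule < Module.finrank ℂ V := fun σ h =>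
        Submodule.finrank_lt fun h' => h (Subrepresentation.toSubmodule_injective h')
      have hτ : τ ≠ ⊤ := by
        rintro rfl
        exact hbot (eq_bot_of_isCompl_top hc)
      obtain ⟨n₁, h₁⟩ := ih _ (key σ htop) σ.toRepresentation rfl
      obtain ⟨n₂, h₂⟩ := ih _ (key τ hτ) τ.toRepresentation rfl
      refine ⟨n₁ + n₂, fun g => ?_⟩
      simp [character_eq_add_of_isCompl hc, h₁, h₂, add_mul, Finset.sum_add_distrib]

/-- The character of the regular representation. -/
theorem leftRegular_character {k G : Type*} [Field k] [Group G] [Fintype G] [DecidableEq G]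
    (g : G) :
    (Representation.leftRegular k G).character g = if g = 1 then (Fintype.card G : k) else 0 := by
  rw [Representation.character, LinearMap.trace_eq_matrix_trace k (MonoidAlgebra.basis G k),
    Matrix.trace]
  have h (x : G) : LinearMap.toMatrix (MonoidAlgebra.basis G k) (MonoidAlgebra.basis G k)
      (Representation.leftRegular k G g) x x = if g = 1 then 1 else 0 := by
    simp [LinearMap.toMatrix_apply, MonoidAlgebra.basis, Finsupp.single_apply]
  simp only [Matrix.diag_apply, h]
  split_ifs <;> simp

/-- Column orthogonality with the identity: `∑ d_ρ χ_ρ(g)` is the regular character. -/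
theorem sum_finrank_mul_character {G : Type} [Group G] [Fintype G] [DecidableEq G]
    {ι : Type} [Fintype ι] (Irr : ι → FDRep ℂ G)
    (hsimple : ∀ i, CategoryTheory.Simple (Irr i))
    (hdistinct : ∀ i j, Nonempty (Irr i ≅ Irr j) → i = j)
    (hcomplete : ∀ V : FDRep ℂ G, CategoryTheory.Simple V → ∃ i, Nonempty (V ≅ Irr i)) (g : G) :
    ∑ i, (Module.finrank ℂ (Irr i) : ℂ) * (Irr i).character g =
      if g = 1 then (Fintype.card G : ℂ) else 0 := by
  classical
  have hN : (Nat.card G : ℂ) ≠ 0 := NeZero.ne _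
  have := invertibleOfNonzero hN
  obtain ⟨n, hn⟩ := exists_character_eq_sum Irr hcomplete (Representation.leftRegular ℂ G)
  have hmult : ∀ j, (Module.finrank ℂ (Irr j) : ℂ) = n j := fun j => by
    have h₁ : (Nat.card G : ℂ)⁻¹ * ∑ x : G,
        (Representation.leftRegular ℂ G).character x * (Irr j).character x⁻¹ =
          Module.finrank ℂ (Irr j) := by
      simp only [leftRegular_character, ite_mul, zero_mul, Finset.sum_ite_eq', Finset.mem_univ,
        if_true, inv_one, FDRep.char_one, ← Nat.card_eq_fintype_card]
      rw [inv_mul_cancel_left₀ hN]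
    rw [← h₁]
    have h₂ : ∀ i, (Nat.card G : ℂ)⁻¹ * ∑ x : G, (Irr i).character x * (Irr j).character x⁻¹ =
        if i = j then 1 else 0 := fun i => by
      have := hsimple i
      have := hsimple j
      rw [FDRep.char_orthonormal]
      exact if_congr ⟨hdistinct i j, fun h => h ▸ ⟨.refl _⟩⟩ rfl rfl
    calc _ = ∑ i, (n i : ℂ) * ((Nat.card G : ℂ)⁻¹ *
          ∑ x : G, (Irr i).character x * (Irr j).character x⁻¹) := by
          simp only [hn, Finset.sum_mul, Finset.mul_sum]
          rw [Finset.sum_comm]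
          exact Finset.sum_congr rfl fun i _ => Finset.sum_congr rfl fun x _ => by ring
      _ = n j := by
        simp only [h₂, mul_ite, mul_one, mul_zero, Finset.sum_ite_eq', Finset.mem_univ, if_true]
  simp only [hmult, ← hn, leftRegular_character]

/-- The total weight of the words of length `t + 1` over `S` with last letter `s` and product `g`,
where each repeated adjacent pair contributes `a` and every other adjacent pair `b`. -/
def wordWeight {G R : Type*} [Group G] [Fintype G] [DecidableEq G] [CommSemiring R]
    (S : Finset G) (a b : R) (t : ℕ) (s g : G) : R :=
  ∑ w : Fin (t + 1) → G,
    if (∀ i, w i ∈ S) ∧ w (Fin.last t) = s ∧ (List.ofFn w).prod = g then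
      ∏ i : Fin t, if w i.castSucc = w i.succ then a else b
    else 0

section wordWeight

variable {G R : Type*} [Group G] [Fintype G] [DecidableEq G] [CommSemiring R]
  {S : Finset G} (a b : R)

theorem wordWeight_zero {s : G} (hs : s ∈ S) (g : G) :
    wordWeight S a b 0 s g = if g = s then 1 else 0 := by
  rw [wordWeight, ← (Equiv.funUnique (Fin 1) G).symm.sum_comp, Finset.sum_eq_single s]
  · simp [hs, eq_comm]
  · simp +contextual
  · simp

theorem wordWeight_succ {s : G} (hs : s ∈ S) (t : ℕ) (g : G) :
    wordWeight S a b (t + 1) s g =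
      a * wordWeight S a b t s (g * s⁻¹) +
        b * ∑ s' ∈ S.erase s, wordWeight S a b t s' (g * s⁻¹) := by
  have hR : a * wordWeight S a b t s (g * s⁻¹) +
        b * ∑ s' ∈ S.erase s, wordWeight S a b t s' (g * s⁻¹) =
      ∑ s' ∈ S, (if s' = s then a else b) * wordWeight S a b t s' (g * s⁻¹) := by
    rw [← Finset.add_sum_erase S _ hs, if_pos rfl, Finset.mul_sum]
    congr 1
    exact Finset.sum_congr rfl fun x hx => by rw [if_neg (Finset.ne_of_mem_erase hx)]
  rw [hR]
  simp only [wordWeight, Finset.mul_sum]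
  rw [Finset.sum_comm, ← (Fin.snocEquiv fun _ : Fin (t + 2) => G).sum_comp,
    Fintype.sum_prod_type_right]
  refine Finset.sum_congr rfl fun v _ => ?_
  rw [Finset.sum_eq_single s]
  · simp only [Fin.snocEquiv_apply, Fin.forall_fin_succ', Fin.snoc_castSucc, Fin.snoc_last, hs,
      and_true, true_and, List.ofFn_succ', List.concat_eq_append, List.prod_append,
      List.prod_singleton, Fin.prod_univ_castSucc, eq_mul_inv_iff_mul_eq, ← Fin.castSucc_succ]
    have hsnoc : (Fin.snoc v s : Fin (t + 2) → G) (Fin.last t).succ = s := by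
      rw [Fin.succ_last, Fin.snoc_last]
    rw [hsnoc, Finset.sum_eq_single (v (Fin.last t))]
    · simp only [true_and, mul_ite, mul_zero, mul_comm]
    · intro x _ hx
      simp [hx.symm]
    · intro h
      simp [h]
  · intro x _ hx
    simp [hx]
  · simp

end wordWeight

/-- Grouping words by their number of letter changes computes `wordWeight`. -/
theorem sum_wordSet_eq_wordWeight {G : Type} {R : Type*} [Group G] [Fintype G] [DecidableEq G]
    [CommSemiring R] (S : Finset G) (a b : R) (t : ℕ) (s g : G) :
    ∑ k ∈ Finset.range (t + 1), a ^ (t - k) * b ^ k *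
      ∑ w ∈ wordSet S t k s, (if (List.ofFn w).prod = g then (1 : R) else 0) =
      wordWeight S a b t s g := by
  simp only [wordWeight, wordSet, Finset.sum_filter, Finset.mul_sum]
  rw [Finset.sum_comm]
  refine Finset.sum_congr rfl fun w _ => ?_
  set m := (Finset.univ.filter fun i : Fin t => w i.castSucc ≠ w i.succ).card with hm
  have hle : m ≤ t := by simpa using Finset.card_filter_le (Finset.univ : Finset (Fin t)) _
  rw [Finset.sum_eq_single m]
  · rw [Finset.prod_ite, Finset.prod_const, Finset.prod_const]
    have hcard : (Finset.univ.filter fun i : Fin t => w i.castSucc = w i.succ).card = t - m := by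
      have := Finset.card_filter_add_card_filter_not (s := (Finset.univ : Finset (Fin t)))
        fun i => w i.castSucc = w i.succ
      rw [Finset.card_univ, Fintype.card_fin] at this
      exact Nat.eq_sub_of_add_eq this
    rw [hcard]
    simp only [← hm, and_true, ← and_assoc]
    split_ifs <;> simp_all
  · intro k _ hk
    simp [hk.symm]
  · intro h
    exact absurd (Finset.mem_range.2 (Nat.lt_succ_of_le hle)) h

/-- The amplitudes of the Grover walk are sums over weighted words. -/
theorem amplitude_eq_wordWeight {G : Type*} [Group G] [Fintype G] [DecidableEq G] {S : Finset G}
    {a b c : ℂ} (hab : a + b * (S.card - 1) = 1) (α : G → ℕ → G → ℂ)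
    (hinit : ∀ s ∈ S, ∀ g : G, α s 0 g = if g = 1 then c else 0)
    (hrec : ∀ s ∈ S, ∀ t : ℕ, ∀ g : G,
      α s (t + 1) g = a * α s t (g * s⁻¹) + b * ∑ s' ∈ S.erase s, α s' t (g * s⁻¹))
    (t : ℕ) {s : G} (hs : s ∈ S) (g : G) :
    α s (t + 1) g = c * wordWeight S a b t s g := by
  induction t generalizing s g with
  | zero =>
    have hsum : ∑ s' ∈ S.erase s, α s' 0 (g * s⁻¹) =
        ∑ s' ∈ S.erase s, if g * s⁻¹ = 1 then c else 0 :=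
      Finset.sum_congr rfl fun x hx => hinit x (Finset.mem_of_mem_erase hx) _
    rw [hrec s hs, hinit s hs, hsum, wordWeight_zero a b hs, Finset.sum_const,
      Finset.card_erase_of_mem hs, nsmul_eq_mul, Nat.cast_pred (Finset.card_pos.2 ⟨s, hs⟩)]
    simp only [mul_inv_eq_one]
    split_ifs
    · linear_combination c * hab
    · simp
  | succ t ih =>
    have hsum : ∑ s' ∈ S.erase s, α s' (t + 1) (g * s⁻¹) =
        ∑ s' ∈ S.erase s, c * wordWeight S a b t s' (g * s⁻¹) :=
      Finset.sum_congr rfl fun x hx => ih (Finset.mem_of_mem_erase hx) _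
    rw [hrec s hs, ih hs, hsum, wordWeight_succ a b hs, ← Finset.mul_sum]
    ring

/-- For the Grover-coin discrete-time coined quantum walk on a finite group `G`
with generating set `S`, started from the uniform superposition over the coin at the identity,
the amplitudes admit the character-sum expression: for every `t ≥ 1` (here `t + 1`), `s ∈ S`
and `g ∈ G`,
`α_{s,t}(g) = (1/(√d·N)) ∑_{k=0}^{t−1} a^{t−k−1} b^k ∑_{ρ ∈ Ĝ} ∑_{w ∈ R_{k,t,s}} d_ρ · χ_ρ(g⁻¹ w_1⋯w_t)`,
where `Ĝ` is a complete set of representatives `Irr : ι → FDRep ℂ G` of the isomorphism classes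
of irreducible complex representations of `G`. -/
theorem grover_walk_amplitude_character_sum
    {G : Type} [Group G] [Fintype G] [DecidableEq G]
    (S : Finset G) (hgen : Subgroup.closure (S : Set G) = ⊤) (hd : 3 ≤ S.card)
    (a b : ℝ) (ha : a = 2 / S.card - 1) (hb : b = 2 / S.card)
    (α : G → ℕ → G → ℂ)
    (hinit : ∀ s ∈ S, ∀ g : G,
      α s 0 g = if g = 1 then (Real.sqrt S.card : ℂ)⁻¹ else 0)
    (hrec : ∀ s ∈ S, ∀ t : ℕ, ∀ g : G,
      α s (t + 1) g =
        (a : ℂ) * α s t (g * s⁻¹) + (b : ℂ) * ∑ s' ∈ S.erase s, α s' t (g * s⁻¹))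
    -- `Irr` is a complete set of representatives of the isomorphism classes of
    -- irreducible complex representations of `G`.
    (ι : Type) [Fintype ι] (Irr : ι → FDRep ℂ G)
    (hsimple : ∀ i, CategoryTheory.Simple (Irr i))
    (hdistinct : ∀ i j, Nonempty (Irr i ≅ Irr j) → i = j)
    (hcomplete : ∀ V : FDRep ℂ G, CategoryTheory.Simple V → ∃ i, Nonempty (V ≅ Irr i))
    (t : ℕ) (s : G) (hs : s ∈ S) (g : G) :
    α s (t + 1) g =
      ((Real.sqrt S.card : ℂ) * (Fintype.card G : ℂ))⁻¹ *
        ∑ k ∈ Finset.range (t + 1),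
          (a : ℂ) ^ (t - k) * (b : ℂ) ^ k *
            ∑ i : ι, ∑ w ∈ wordSet S t k s,
              (Module.finrank ℂ (Irr i) : ℂ) *
                (Irr i).character (g⁻¹ * (List.ofFn w).prod) := by
  have hN : (Fintype.card G : ℂ) ≠ 0 := Nat.cast_ne_zero.2 Fintype.card_ne_zero
  have hS : (S.card : ℂ) ≠ 0 := Nat.cast_ne_zero.2 (by omega)
  have hab : (a : ℂ) + b * (S.card - 1) = 1 := by
    rw [ha, hb]
    push_cast
    field_simp
    ring
  rw [amplitude_eq_wordWeight hab α hinit hrec t hs, ← sum_wordSet_eq_wordWeight, mul_inv,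
    mul_assoc]
  congr 1
  rw [Finset.mul_sum]
  refine Finset.sum_congr rfl fun k _ => ?_
  rw [Finset.sum_comm]
  simp only [sum_finrank_mul_character Irr hsimple hdistinct hcomplete, inv_mul_eq_one,
    eq_comm (a := g)]
  rw [mul_left_comm, Finset.mul_sum (s := wordSet S t k s) (a := (Fintype.card G : ℂ)⁻¹)]
  simp only [mul_ite, inv_mul_cancel₀ hN, mul_zero]
end

section
/- For the Grover-coin discrete-time coined quantum walk on a finite group G with generating set S, started from the uniform superposition over the coin at the identity, the amplitudes are given by the path-counting formula: for every t ≥ 1, s ∈ S and g ∈ G, α_{s,t}(g) = (1/√d) · ∑_{k=0}^{t−1} a^{t−k−1} b^k · #_{k,t,s}(g). -/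
/-- `pathCount S n k s g = #_{k,n+1,s}(g)`, the number of words in `R_{k,n+1,s}` whose
product equals `g`. -/
def pathCount {G : Type} [Group G] [Fintype G] [DecidableEq G]
    (S : Finset G) (n k : ℕ) (s g : G) : ℕ :=
  ((wordSet S n k s).filter fun w => (List.ofFn w).prod = g).card

/-- The sum, over the words `w` of length `n + 1` in `S` with last letter `s` and product `g`, of
the product of `a` for every pair of equal adjacent letters and `b` for every other pair. -/
noncomputable def wordWeightSum {G : Type} [Group G] [Fintype G] [DecidableEq G]
    (S : Finset G) (a b : ℂ) (n : ℕ) (s g : G) : ℂ :=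
  ∑ w : Fin (n + 1) → G,
    if (∀ i, w i ∈ S) ∧ w (Fin.last n) = s ∧ (List.ofFn w).prod = g then
      ∏ i : Fin n, (if w i.castSucc ≠ w i.succ then b else a) else 0

theorem wordWeightSum_zero {G : Type} [Group G] [Fintype G] [DecidableEq G]
    (S : Finset G) (a b : ℂ) {s : G} (hs : s ∈ S) (g : G) :
    wordWeightSum S a b 0 s g = if s = g then 1 else 0 := by
  rw [wordWeightSum, Fintype.sum_eq_single (fun _ => s)]
  · simp [hs]
  · intro w hw
    rw [if_neg]
    rintro ⟨-, h, -⟩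
    refine hw (funext fun i => ?_)
    rw [← h, (Fin.eq_zero i).trans (Fin.last_zero).symm]

theorem wordWeightSum_succ {G : Type} [Group G] [Fintype G] [DecidableEq G]
    (S : Finset G) (a b : ℂ) (n : ℕ) {s : G} (hs : s ∈ S) (g : G) :
    wordWeightSum S a b (n + 1) s g =
      ∑ s' ∈ S, (if s' ≠ s then b else a) * wordWeightSum S a b n s' (g * s⁻¹) := by
  have hlhs : wordWeightSum S a b (n + 1) s g =
      ∑ v : Fin (n + 1) → G,
        if (∀ i, v i ∈ S) ∧ (List.ofFn v).prod = g * s⁻¹ then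
          (∏ i : Fin n, (if v i.castSucc ≠ v i.succ then b else a)) *
            (if v (Fin.last n) ≠ s then b else a) else 0 := by
    rw [wordWeightSum, ← (Fin.snocEquiv fun _ => G).sum_comp, Fintype.sum_prod_type,
      Fintype.sum_eq_single s]
    · refine Finset.sum_congr rfl fun v _ => ?_
      have hprod : (List.ofFn (Fin.snoc (α := fun _ => G) v s)).prod = (List.ofFn v).prod * s := by
        rw [List.ofFn_succ']
        simp only [Fin.snoc_castSucc, Fin.snoc_last, List.concat_eq_append, List.prod_append,
          List.prod_singleton]
      change (if _ ∧ _ ∧ (List.ofFn (Fin.snoc (α := fun _ => G) v s)).prod = g then _ else _) = _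
      simp only [Fin.snocEquiv_apply, Fin.forall_fin_succ', Fin.snoc_castSucc, Fin.snoc_last, hs,
        hprod, true_and, and_true, eq_mul_inv_iff_mul_eq, Fin.prod_univ_castSucc, Fin.succ_last,
        Fin.succ_castSucc]
    · intro x hx
      refine Finset.sum_eq_zero fun v _ => if_neg ?_
      rintro ⟨-, h, -⟩
      exact hx (by simpa using h)
  rw [hlhs]
  simp only [wordWeightSum, Finset.mul_sum]
  rw [Finset.sum_comm]
  refine Finset.sum_congr rfl fun v _ => ?_
  by_cases hv : (∀ i, v i ∈ S) ∧ (List.ofFn v).prod = g * s⁻¹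
  · rw [if_pos hv, Finset.sum_eq_single_of_mem (v (Fin.last n)) (hv.1 _)]
    · rw [mul_comm, if_pos (c := _ ∧ _ ∧ _) ⟨hv.1, rfl, hv.2⟩]
    · intro s' _ hs'
      rw [if_neg (c := _ ∧ _ ∧ _) fun h => hs' h.2.1.symm, mul_zero]
  · rw [if_neg hv]
    refine (Finset.sum_eq_zero fun s' _ => ?_).symm
    rw [if_neg (c := _ ∧ _ ∧ _) fun h => hv ⟨h.1, h.2.2⟩, mul_zero]

theorem wordWeightSum_eq_sum_pathCount {G : Type} [Group G] [Fintype G] [DecidableEq G]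
    (S : Finset G) (a b : ℂ) (n : ℕ) (s g : G) :
    wordWeightSum S a b n s g =
      ∑ k ∈ Finset.range (n + 1), a ^ (n - k) * b ^ k * (pathCount S n k s g : ℂ) := by
  rw [wordWeightSum, ← Finset.sum_filter,
    ← Finset.sum_fiberwise_of_maps_to (t := Finset.range (n + 1))
      (g := fun w => (Finset.univ.filter fun i : Fin n => w i.castSucc ≠ w i.succ).card)]
  · refine Finset.sum_congr rfl fun k _ => ?_
    rw [Finset.sum_congr rfl (g := fun _ => a ^ (n - k) * b ^ k), Finset.sum_const, nsmul_eq_mul,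
      mul_comm, pathCount, wordSet, Finset.filter_filter, Finset.filter_filter]
    · congr 4
      ext w
      tauto
    · intro w hw
      have hk := (Finset.mem_filter.mp hw).2
      have hcompl := Finset.card_filter_add_card_filter_not (s := (Finset.univ : Finset (Fin n)))
        (fun i => w i.castSucc ≠ w i.succ)
      rw [hk, Finset.card_univ, Fintype.card_fin] at hcompl
      rw [Finset.prod_ite, Finset.prod_const, Finset.prod_const, hk, mul_comm,
        ← Nat.eq_sub_of_add_eq' hcompl]
  · intro w _
    refine Finset.mem_range_succ_iff.mpr ((Finset.card_le_univ _).trans ?_)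
    rw [Fintype.card_fin]

/-- For the Grover-coin discrete-time coined quantum walk on a finite group `G`
with generating set `S`, started from the uniform superposition over the coin at the identity,
the amplitudes are given by the path-counting formula: for every `t ≥ 1` (here `t + 1`),
`s ∈ S` and `g ∈ G`,
`α_{s,t}(g) = (1/√d) · ∑_{k=0}^{t−1} a^{t−k−1} b^k · #_{k,t,s}(g)`. -/
theorem grover_walk_amplitude_path_counting
    {G : Type} [Group G] [Fintype G] [DecidableEq G]
    (S : Finset G) (hgen : Subgroup.closure (S : Set G) = ⊤) (hd : 3 ≤ S.card)
    (a b : ℝ) (ha : a = 2 / S.card - 1) (hb : b = 2 / S.card)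
    (α : G → ℕ → G → ℂ)
    (hinit : ∀ s ∈ S, ∀ g : G,
      α s 0 g = if g = 1 then (Real.sqrt S.card : ℂ)⁻¹ else 0)
    (hrec : ∀ s ∈ S, ∀ t : ℕ, ∀ g : G,
      α s (t + 1) g =
        (a : ℂ) * α s t (g * s⁻¹) + (b : ℂ) * ∑ s' ∈ S.erase s, α s' t (g * s⁻¹))
    (t : ℕ) (s : G) (hs : s ∈ S) (g : G) :
    α s (t + 1) g =
      (Real.sqrt S.card : ℂ)⁻¹ *
        ∑ k ∈ Finset.range (t + 1),
          (a : ℂ) ^ (t - k) * (b : ℂ) ^ k * (pathCount S t k s g : ℂ) := by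
  rw [← wordWeightSum_eq_sum_pathCount]
  induction t generalizing s g with
  | zero =>
    have hcard : (S.card : ℂ) ≠ 0 := Nat.cast_ne_zero.mpr (by omega)
    have hcoin : (a : ℂ) + b * ((S.card : ℂ) - 1) = 1 := by
      rw [ha, hb]
      push_cast
      field_simp
      ring
    rw [hrec s hs, wordWeightSum_zero S _ _ hs, hinit s hs,
      Finset.sum_congr rfl fun s' hs' => hinit s' (Finset.mem_of_mem_erase hs') _,
      Finset.sum_const, Finset.card_erase_of_mem hs, nsmul_eq_mul,
      Nat.cast_sub (by omega), Nat.cast_one]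
    simp only [mul_inv_eq_one, eq_comm (a := g)]
    split_ifs
    · linear_combination (Real.sqrt S.card : ℂ)⁻¹ * hcoin
    · simp
  | succ t ih =>
    have hother : ∑ s' ∈ S.erase s,
        (if s' ≠ s then (b : ℂ) else a) * wordWeightSum S a b t s' (g * s⁻¹) =
          b * ∑ s' ∈ S.erase s, wordWeightSum S a b t s' (g * s⁻¹) := by
      rw [Finset.mul_sum]
      exact Finset.sum_congr rfl fun s' hs' => by rw [if_pos (Finset.ne_of_mem_erase hs')]
    rw [hrec s hs, wordWeightSum_succ S _ _ t hs, ← Finset.add_sum_erase S _ hs, ih s hs,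
      Finset.sum_congr rfl fun s' hs' => ih s' (Finset.mem_of_mem_erase hs') _, hother,
      if_neg (not_not.mpr rfl), ← Finset.mul_sum]
    ring
end

section
/- If the generating set S is conjugate invariant, then the amplitudes of the Grover-coin walk started from the uniform superposition over the coin at the identity satisfy the conjugation identity: for every t ∈ ℕ, s ∈ S, g ∈ G and τ ∈ G, α_{s,t}(τ g τ⁻¹) = α_{τ⁻¹ s τ, t}(g). -/
/-- If the generating set `S` is conjugate invariant, then the amplitudes of
the Grover-coin walk started from the uniform superposition over the coin at the identity
satisfy the conjugation identity: for every `t ∈ ℕ`, `s ∈ S`, `g ∈ G` and `τ ∈ G`,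
`α_{s,t}(τ g τ⁻¹) = α_{τ⁻¹ s τ, t}(g)`. -/
theorem grover_walk_amplitude_conjugation
    {G : Type} [Group G] [Fintype G] [DecidableEq G]
    (S : Finset G) (hgen : Subgroup.closure (S : Set G) = ⊤) (hd : 3 ≤ S.card)
    (a b : ℝ) (ha : a = 2 / S.card - 1) (hb : b = 2 / S.card)
    (α : G → ℕ → G → ℂ)
    (hinit : ∀ s ∈ S, ∀ g : G,
      α s 0 g = if g = 1 then (Real.sqrt S.card : ℂ)⁻¹ else 0)
    (hrec : ∀ s ∈ S, ∀ t : ℕ, ∀ g : G,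
      α s (t + 1) g =
        (a : ℂ) * α s t (g * s⁻¹) + (b : ℂ) * ∑ s' ∈ S.erase s, α s' t (g * s⁻¹))
    (hconj : ∀ s ∈ S, ∀ τ : G, τ * s * τ⁻¹ ∈ S)
    (t : ℕ) (s : G) (hs : s ∈ S) (g τ : G) :
    α s t (τ * g * τ⁻¹) = α (τ⁻¹ * s * τ) t g := by
  have hconj' : ∀ s ∈ S, τ⁻¹ * s * τ ∈ S := fun s hs => by simpa using hconj s hs τ⁻¹
  induction t generalizing s g with
  | zero =>
    rw [hinit s hs, hinit _ (hconj' s hs)]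
    simp only [conj_eq_one_iff]
  | succ t ih =>
    have hshift : τ * g * τ⁻¹ * s⁻¹ = τ * (g * (τ⁻¹ * s * τ)⁻¹) * τ⁻¹ := by group
    rw [hrec s hs, hrec _ (hconj' s hs), hshift, ih s hs]
    congr 2
    refine Finset.sum_bij' (fun x _ => τ⁻¹ * x * τ) (fun x _ => τ * x * τ⁻¹) ?_ ?_ ?_ ?_ ?_
    · intro x hx
      rw [Finset.mem_erase] at hx ⊢
      exact ⟨by simpa using hx.1, hconj' x hx.2⟩
    · intro x hx
      rw [Finset.mem_erase] at hx ⊢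
      refine ⟨fun h => hx.1 ?_, hconj x hx.2 τ⟩
      rw [← h]
      group
    · intro x _
      group
    · intro x _
      group
    · intro x hx
      exact ih x (Finset.mem_of_mem_erase hx) _
end

section
/- For the Hadamard walk on the Cayley graph of the symmetric group S_n generated by μ = (1 2) and σ = (1 2 ⋯ n), started from the basis state (0, e), the amplitudes after t ≥ 1 steps are: for s ∈ {0,1} and g ∈ S_n, α_{s,t}(g) = 2^{−t/2} · ∑_{k ∈ {0,…,2^t−1}, k ≡ s (mod 2), k̂ = g} W_t(k), where the sum is over those t-bit integers k whose least significant bit equals s and whose associated group element k̂ equals g. -/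
/-- The group element `k̂` associated with a `t`-bit integer `k` (most significant bit first):
bit `1` stands for `σ` and bit `0` for `μ`. -/
def bitWord {n : ℕ} (μ σ : Equiv.Perm (Fin n)) (t k : ℕ) : Equiv.Perm (Fin n) :=
  (List.ofFn fun i : Fin t => if k.testBit (t - 1 - (i : ℕ)) then σ else μ).prod

theorem bitWord_two_mul_add {n : ℕ} (μ σ : Equiv.Perm (Fin n)) (t k b : ℕ) (hb : b < 2) :
    bitWord μ σ (t + 1) (2 * k + b) = bitWord μ σ t k * if b = 1 then σ else μ := by
  unfold bitWord
  rw [List.ofFn_succ', List.concat_eq_append, List.prod_append]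
  congr 1
  · congr 2
    funext i
    have h : t + 1 - 1 - (i.castSucc : ℕ) = (t - 1 - (i : ℕ)) + 1 := by
      have := i.isLt
      simp only [Fin.val_castSucc]
      omega
    rw [h, Nat.testBit_succ, show (2 * k + b) / 2 = k by omega]
  · have h : (2 * k + b) % 2 = b := by omega
    simp [Nat.testBit_zero, h]

theorem sum_range_two_mul_filter_mod_two {M : Type*} [AddCommMonoid M] (N s : ℕ) (hs : s < 2)
    (P : ℕ → Prop) [DecidablePred P] (f : ℕ → M) :
    ∑ k ∈ (Finset.range (2 * N)).filter (fun k => k % 2 = s ∧ P k), f k =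
      ∑ j ∈ (Finset.range N).filter (fun j => P (2 * j + s)), f (2 * j + s) := by
  symm
  refine Finset.sum_nbij' (fun j => 2 * j + s) (fun k => k / 2) ?_ ?_ ?_ ?_ ?_
  · intro j hj
    simp only [Finset.mem_filter, Finset.mem_range] at hj ⊢
    exact ⟨by omega, by omega, hj.2⟩
  · intro k hk
    simp only [Finset.mem_filter, Finset.mem_range] at hk ⊢
    obtain ⟨h1, h2, h3⟩ := hk
    refine ⟨by omega, ?_⟩
    rwa [show 2 * (k / 2) + s = k by omega]
  · intro j _
    omega
  · intro k hk
    simp only [Finset.mem_filter, Finset.mem_range] at hk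
    omega
  · intro j _
    rfl

/-- The sign sequence, defined by its most significant bits, also satisfies a recursion in its
least significant bit. -/
theorem signSequence_two_mul_add (W : ℕ → ℕ → ℤ) (hW1 : W 1 0 = 1 ∧ W 1 1 = 1)
    (hWrec : ∀ t : ℕ, 2 ≤ t → ∀ k < 2 ^ t,
      (k < 2 ^ (t - 1) → W t k = W (t - 1) k) ∧
      (2 ^ (t - 1) ≤ k → k < 2 ^ (t - 1) + 2 ^ (t - 2) →
        W t k = W (t - 1) (k - 2 ^ (t - 1))) ∧
      (2 ^ (t - 1) + 2 ^ (t - 2) ≤ k → W t k = -W (t - 1) (k - 2 ^ (t - 1))))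
    (t k b : ℕ) (hk : k < 2 ^ (t + 1)) (hb : b < 2) :
    W (t + 2) (2 * k + b) = if b = 1 ∧ k % 2 = 1 then -W (t + 1) k else W (t + 1) k := by
  induction t generalizing k with
  | zero =>
    have h := hWrec 2 le_rfl (2 * k + b)
    obtain ⟨h0, h1⟩ := hW1
    norm_num at h hk ⊢
    interval_cases k <;> interval_cases b <;> simp_all
  | succ t ih =>
    obtain ⟨a1, a2, a3⟩ := hWrec (t + 3) (by omega) (2 * k + b) (by rw [pow_succ 2 (t + 2)]; change k < 2 ^ (t + 2) at hk; omega)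
    obtain ⟨b1, b2, b3⟩ := hWrec (t + 2) (by omega) k hk
    simp only [show t + 3 - 1 = t + 2 by omega, show t + 3 - 2 = t + 1 by omega,
      show t + 2 - 1 = t + 1 by omega, show t + 2 - 2 = t by omega] at a1 a2 a3 b1 b2 b3
    have e1 : 2 ^ (t + 1) = 2 * 2 ^ t := by ring
    have e2 : 2 ^ (t + 2) = 2 * (2 * 2 ^ t) := by ring
    rw [show t + 1 + 1 = t + 2 by rfl] at hk ⊢
    rw [show t + 1 + 2 = t + 3 by rfl]
    by_cases c1 : k < 2 ^ (t + 1)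
    · rw [a1 (by omega), b1 c1, ih k c1]
    · have hsub : 2 * k + b - 2 ^ (t + 2) = 2 * (k - 2 ^ (t + 1)) + b := by omega
      have hi := ih (k - 2 ^ (t + 1)) (by omega)
      rw [show (k - 2 ^ (t + 1)) % 2 = k % 2 by omega] at hi
      by_cases c2 : k < 2 ^ (t + 1) + 2 ^ t
      · rw [a2 (by omega) (by omega), b2 (by omega) c2, hsub, hi]
      · rw [a3 (by omega), b3 (by omega), hsub, hi]
        split_ifs <;> rfl

theorem sum_bitWord_succ {n : ℕ} (μ σ : Equiv.Perm (Fin n)) (t s : ℕ) (hs : s < 2)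
    (f : ℕ → ℂ) (g : Equiv.Perm (Fin n)) :
    ∑ k ∈ (Finset.range (2 ^ (t + 1))).filter
        (fun k => k % 2 = s ∧ bitWord μ σ (t + 1) k = g), f k =
      ∑ j ∈ (Finset.range (2 ^ t)).filter
        (fun j => bitWord μ σ t j = g * (if s = 1 then σ else μ)⁻¹), f (2 * j + s) := by
  rw [pow_succ', sum_range_two_mul_filter_mod_two _ _ hs]
  simp only [bitWord_two_mul_add μ σ t _ s hs, eq_mul_inv_iff_mul_eq]

theorem sum_filter_eq_add_mod_two {M : Type*} [AddCommMonoid M] (S : Finset ℕ) (P : ℕ → Prop)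
    [DecidablePred P] (f : ℕ → M) :
    ∑ k ∈ S.filter P, f k =
      ∑ k ∈ S.filter (fun k => k % 2 = 0 ∧ P k), f k +
        ∑ k ∈ S.filter (fun k => k % 2 = 1 ∧ P k), f k := by
  rw [← Finset.sum_filter_add_sum_filter_not (S.filter P) (fun k => k % 2 = 0)]
  simp only [Finset.filter_filter, Nat.mod_two_ne_zero, and_comm]

/-- For the Hadamard walk on the Cayley graph of the symmetric group `S_n`
(`n ≥ 3`, here `n = m + 3`) generated by `μ = (1 2)` and `σ = (1 2 ⋯ n)`, started from the
basis state `(0, e)`, the amplitudes after `t ≥ 1` steps (here `t + 1`) are: for `s ∈ {0,1}`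
and `g ∈ S_n`, `α_{s,t}(g) = 2^{−t/2} · ∑_{k ∈ [2^t], k ≡ s (mod 2), k̂ = g} W_t(k)`, where
`W` is the recursively defined sign sequence (`W_t` of length `2^t`): `W_1 = (1,1)` and
`W_t = [W_{t−1}, first half of W_{t−1}, −(second half of W_{t−1})]` for `t ≥ 2`. -/
theorem hadamard_walk_symmetric_group_amplitude
    (m : ℕ)
    (μ σ : Equiv.Perm (Fin (m + 3)))
    (hμ : μ = Equiv.swap 0 1) (hσ : σ = finRotate (m + 3))
    (α : Fin 2 → ℕ → Equiv.Perm (Fin (m + 3)) → ℂ)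
    (hinit0 : ∀ g, α 0 0 g = if g = 1 then 1 else 0)
    (hinit1 : ∀ g, α 1 0 g = 0)
    (hrec0 : ∀ t : ℕ, ∀ g, α 0 (t + 1) g =
      (Real.sqrt 2 : ℂ)⁻¹ * (α 0 t (g * μ⁻¹) + α 1 t (g * μ⁻¹)))
    (hrec1 : ∀ t : ℕ, ∀ g, α 1 (t + 1) g =
      (Real.sqrt 2 : ℂ)⁻¹ * (α 0 t (g * σ⁻¹) - α 1 t (g * σ⁻¹)))
    -- `W t k` is the `k`-th entry (`0 ≤ k < 2^t`) of the sign sequence `W_t`.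
    (W : ℕ → ℕ → ℤ)
    (hW1 : W 1 0 = 1 ∧ W 1 1 = 1)
    (hWrec : ∀ t : ℕ, 2 ≤ t → ∀ k < 2 ^ t,
      (k < 2 ^ (t - 1) → W t k = W (t - 1) k) ∧
      (2 ^ (t - 1) ≤ k → k < 2 ^ (t - 1) + 2 ^ (t - 2) →
        W t k = W (t - 1) (k - 2 ^ (t - 1))) ∧
      (2 ^ (t - 1) + 2 ^ (t - 2) ≤ k → W t k = -W (t - 1) (k - 2 ^ (t - 1))))
    (t : ℕ) (s : Fin 2) (g : Equiv.Perm (Fin (m + 3))) :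
    α s (t + 1) g =
      (Real.sqrt (2 ^ (t + 1)) : ℂ)⁻¹ *
        ∑ k ∈ (Finset.range (2 ^ (t + 1))).filter
            (fun k => k % 2 = (s : ℕ) ∧ bitWord μ σ (t + 1) k = g),
          (W (t + 1) k : ℂ) := by
  have hsign := signSequence_two_mul_add W hW1 hWrec
  induction t generalizing s g with
  | zero =>
    rw [sum_bitWord_succ μ σ 0 s s.isLt]
    obtain ⟨h0, h1⟩ := hW1
    fin_cases s
    · by_cases hg : g * μ⁻¹ = 1 <;>
        simp [hrec0, hinit0, hinit1, bitWord, h0, hg, eq_comm (a := (1 : Equiv.Perm (Fin (m + 3))))]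
    · by_cases hg : g * σ⁻¹ = 1 <;>
        simp [hrec1, hinit0, hinit1, bitWord, h1, hg, eq_comm (a := (1 : Equiv.Perm (Fin (m + 3))))]
  | succ t ih =>
    have hsqrt : (Real.sqrt (2 ^ (t + 1 + 1)) : ℂ)⁻¹ =
        (Real.sqrt 2 : ℂ)⁻¹ * (Real.sqrt (2 ^ (t + 1)) : ℂ)⁻¹ := by
      rw [pow_succ' (2 : ℝ) (t + 1), Real.sqrt_mul (by norm_num), Complex.ofReal_mul, mul_inv]
    rw [sum_bitWord_succ μ σ (t + 1) s s.isLt, hsqrt, mul_assoc,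
      sum_filter_eq_add_mod_two]
    have hterm : ∀ P : ℕ → Prop, ∀ [DecidablePred P], ∀ r b : ℕ, b < 2 →
        ∑ k ∈ (Finset.range (2 ^ (t + 1))).filter (fun k => k % 2 = r ∧ P k),
            (W (t + 1 + 1) (2 * k + b) : ℂ) =
          (if b = 1 ∧ r = 1 then -1 else 1) *
            ∑ k ∈ (Finset.range (2 ^ (t + 1))).filter (fun k => k % 2 = r ∧ P k),
              (W (t + 1) k : ℂ) := by
      intro P _ r b hb
      rw [Finset.mul_sum]
      refine Finset.sum_congr rfl fun k hk => ?_
      simp only [Finset.mem_filter, Finset.mem_range] at hk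
      rw [hsign t k b hk.1 hb, hk.2.1]
      split_ifs <;> simp
    rw [hterm _ 0 s s.isLt, hterm _ 1 s s.isLt]
    fin_cases s
    · change α 0 (t + 1 + 1) g = _
      rw [hrec0, ih, ih, ← mul_add]
      simp
    · change α 1 (t + 1 + 1) g = _
      rw [hrec1, ih, ih, ← mul_sub]
      simp [sub_eq_add_neg]
end
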